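/- For each k ≥ 1, let g_n^{(k)} denote the number of λυ-terms of size n that ψ-normalise in exactly k normal-order ψ-reduction steps, and let G_k(z) = ∑_n g_n^{(k)} z^n. Then there exist a finite non-empty index set I and non-negative integers ζ_i, τ_i, σ_i, ν_i, ρ_{i,0},…,ρ_{i,k−1} for i ∈ I such that G_k(z) = (1/(1 − z − 2z·L_∞(z))) · ∑_{i∈I} z^{ζ_i} T(z)^{τ_i} S(z)^{σ_i} N(z)^{ν_i} ∏_{0 ≤ j < k} G_j(z)^{ρ_{i,j}}, where T(z), S(z), N(z) are the generating functions of λυ-terms, substitutions and de Bruijn indices, L_∞(z) = G_0(z) is the generating function of pure terms, and all identities hold as formal power series. -/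

import Mathlib

mutual
/-- λυ-terms in de Bruijn notation, with explicit closures. -/
inductive LTerm : Type
  | idx : Nat → LTerm
  | lam : LTerm → LTerm
  | app : LTerm → LTerm → LTerm
  | clos : LTerm → LSub → LTerm
  deriving DecidableEq

/-- explicit λυ-substitutions. -/
inductive LSub : Type
  | slash : LTerm → LSub
  | lift : LSub → LSub
  | shift : LSub
  deriving DecidableEq
end

mutual
/-- natural size of a λυ-term: the number of constructors (|idx n| = n+1). -/
def LTerm.size : LTerm → Nat
  | .idx n => n + 1
  | .lam a => 1 + a.size
  | .app a b => 1 + a.size + b.size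
  | .clos a s => 1 + a.size + s.size

/-- natural size of a substitution. -/
def LSub.size : LSub → Nat
  | .slash a => 1 + a.size
  | .lift s => 1 + s.size
  | .shift => 1
end

/-- a λυ-term is pure if it contains no closure; pure terms are exactly the ψ-normal forms. -/
def LTerm.IsPure : LTerm → Prop
  | .idx _ => True
  | .lam a => a.IsPure
  | .app a b => a.IsPure ∧ b.IsPure
  | .clos _ _ => False

/-- one normal-order (leftmost-outermost) ψ-reduction step. -/
inductive NStep : LTerm → LTerm → Prop
  /-- (App) (ab)[s] → a[s](b[s]) -/
  | appS (a b : LTerm) (s : LSub) :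
      NStep (.clos (.app a b) s) (.app (.clos a s) (.clos b s))
  /-- (Lambda) (λa)[s] → λ(a[⇑(s)]) -/
  | lamS (a : LTerm) (s : LSub) :
      NStep (.clos (.lam a) s) (.lam (.clos a (.lift s)))
  /-- (FVar) 0[a/] → a -/
  | fvar (a : LTerm) : NStep (.clos (.idx 0) (.slash a)) a
  /-- (RVar) (S n)[a/] → n -/
  | rvar (n : Nat) (a : LTerm) : NStep (.clos (.idx (n+1)) (.slash a)) (.idx n)
  /-- (FVarLift) 0[⇑(s)] → 0 -/
  | fvarLift (s : LSub) : NStep (.clos (.idx 0) (.lift s)) (.idx 0)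
  /-- (RVarLift) (S n)[⇑(s)] → n[s][↑] -/
  | rvarLift (n : Nat) (s : LSub) :
      NStep (.clos (.idx (n+1)) (.lift s)) (.clos (.clos (.idx n) s) .shift)
  /-- (VarShift) n[↑] → S n -/
  | varShift (n : Nat) : NStep (.clos (.idx n) .shift) (.idx (n+1))
  /-- reduce under an abstraction -/
  | lamCong {a a' : LTerm} : NStep a a' → NStep (.lam a) (.lam a')
  /-- reduce in the left part of an application -/
  | appLeft {a a' : LTerm} (b : LTerm) : NStep a a' → NStep (.app a b) (.app a' b)
  /-- reduce in the right part of an application, provided the left part is normal -/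
  | appRight {b b' : LTerm} (a : LTerm) :
      a.IsPure → NStep b b' → NStep (.app a b) (.app a b')
  /-- reduce in the body of a closure, provided the closure is not itself a ψ-redex,
      i.e. its body is again a closure -/
  | closCong {t t' : LTerm} (s : LSub) :
      (∃ u v, t = LTerm.clos u v) → NStep t t' → NStep (.clos t s) (.clos t' s)

/-- `NormIn t k` : `t` reaches its ψ-normal form in exactly `k` normal-order
ψ-reduction steps (written t ↓_k). -/
inductive NormIn : LTerm → Nat → Prop
  | base {t : LTerm} : t.IsPure → NormIn t 0
  | step {t t' : LTerm} {k : Nat} : NStep t t' → NormIn t' k → NormIn t (k+1)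

open PowerSeries in
/-- the generating function G_k(z) = ∑_n g_n^{(k)} z^n, where g_n^{(k)} is the
number of λυ-terms of size n that ψ-normalise in exactly k normal-order
ψ-reduction steps; G_0 = L_∞ is the generating function of pure terms. -/
noncomputable def Gps (k : ℕ) : PowerSeries ℝ :=
  PowerSeries.mk fun n => (Nat.card {t : LTerm // t.size = n ∧ NormIn t k} : ℝ)

/-- the generating function T(z) of all λυ-terms by size. -/
noncomputable def Tps : PowerSeries ℝ :=
  PowerSeries.mk fun n => (Nat.card {t : LTerm // t.size = n} : ℝ)

/-- the generating function S(z) of explicit λυ-substitutions by size. -/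
noncomputable def Sps : PowerSeries ℝ :=
  PowerSeries.mk fun n => (Nat.card {s : LSub // s.size = n} : ℝ)

/-- the generating function N(z) of de Bruijn indices by size (|m| = m+1). -/
noncomputable def Nps : PowerSeries ℝ :=
  PowerSeries.mk fun n => (Nat.card {m : ℕ // m + 1 = n} : ℝ)

namespace PsiReduction

open Set

/-! ### Normal-order reduction -/

theorem not_nStep_of_isPure {t t' : LTerm} (h : NStep t t') : ¬ t.IsPure := by
  induction h <;> simp_all [LTerm.IsPure]

theorem nStep_deterministic {t u v : LTerm} (hu : NStep t u) (hv : NStep t v) : u = v := by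
  induction hu generalizing v with
  | lamCong _ ih => cases hv with | lamCong h => rw [ih h]
  | appLeft b h ih =>
    cases hv with
    | appLeft _ h' => rw [ih h']
    | appRight _ hp _ => exact absurd hp (not_nStep_of_isPure h)
  | appRight a hp h ih =>
    cases hv with
    | appLeft _ h' => exact absurd hp (not_nStep_of_isPure h')
    | appRight _ _ h' => rw [ih h']
  | closCong s hc h ih =>
    obtain ⟨x, y, rfl⟩ := hc
    cases hv with | closCong _ _ h' => rw [ih h']
  | _ =>
    cases hv with
    | closCong _ hc _ => simp at hc
    | _ => rfl

theorem exists_nStep_clos : ∀ (u : LTerm) (s : LSub), ∃ t, NStep (.clos u s) t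
  | .idx 0, .slash a => ⟨_, .fvar a⟩
  | .idx (n + 1), .slash a => ⟨_, .rvar n a⟩
  | .idx 0, .lift s => ⟨_, .fvarLift s⟩
  | .idx (n + 1), .lift s => ⟨_, .rvarLift n s⟩
  | .idx n, .shift => ⟨_, .varShift n⟩
  | .lam a, s => ⟨_, .lamS a s⟩
  | .app a b, s => ⟨_, .appS a b s⟩
  | .clos u v, s =>
    let ⟨_, h⟩ := exists_nStep_clos u v
    ⟨_, .closCong s ⟨u, v, rfl⟩ h⟩

theorem normIn_zero_iff {t : LTerm} : NormIn t 0 ↔ t.IsPure :=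
  ⟨fun h => by cases h; assumption, .base⟩

theorem normIn_succ_iff {t : LTerm} {k : ℕ} :
    NormIn t (k + 1) ↔ ∃ t', NStep t t' ∧ NormIn t' k :=
  ⟨fun h => by cases h with | step h h' => exact ⟨_, h, h'⟩, fun ⟨_, h, h'⟩ => .step h h'⟩

theorem normIn_unique {t : LTerm} {i j : ℕ} (hi : NormIn t i) (hj : NormIn t j) : i = j := by
  induction hi generalizing j with
  | base hp =>
    cases hj with
    | base => rfl
    | step h _ => exact absurd hp (not_nStep_of_isPure h)
  | step h _ ih =>
    cases hj with
    | base hp => exact absurd hp (not_nStep_of_isPure h)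
    | step h' hn =>
      obtain rfl := nStep_deterministic h h'
      rw [ih hn]

theorem normIn_idx_iff {n k : ℕ} : NormIn (.idx n) k ↔ k = 0 := by
  constructor
  · intro h
    cases h with
    | base => rfl
    | step h _ => cases h
  · rintro rfl
    exact .base trivial

theorem normIn_lam_iff {a : LTerm} {k : ℕ} : NormIn (.lam a) k ↔ NormIn a k := by
  induction k generalizing a with
  | zero => simp [normIn_zero_iff, LTerm.IsPure]
  | succ k ih =>
    simp only [normIn_succ_iff]
    constructor
    · rintro ⟨_, h, h'⟩
      cases h with | lamCong h => exact ⟨_, h, ih.1 h'⟩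
    · rintro ⟨_, h, h'⟩
      exact ⟨_, .lamCong h, ih.2 h'⟩

theorem normIn_app {a b : LTerm} {i j : ℕ} (ha : NormIn a i) (hb : NormIn b j) :
    NormIn (.app a b) (i + j) := by
  induction ha with
  | @base a hp =>
    rw [Nat.zero_add]
    induction hb with
    | base hq => exact .base ⟨hp, hq⟩
    | step h _ ih => exact .step (.appRight a hp h) ih
  | step h _ ih =>
    rw [Nat.add_right_comm]
    exact .step (.appLeft b h) ih

theorem normIn_app_iff {a b : LTerm} {k : ℕ} :
    NormIn (.app a b) k ↔ ∃ i j, i + j = k ∧ NormIn a i ∧ NormIn b j := by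
  constructor
  · induction k generalizing a b with
    | zero =>
      intro h
      obtain ⟨ha, hb⟩ := normIn_zero_iff.1 h
      exact ⟨0, 0, rfl, .base ha, .base hb⟩
    | succ k ih =>
      rw [normIn_succ_iff]
      rintro ⟨_, h, h'⟩
      cases h with
      | appLeft _ h =>
        obtain ⟨i, j, rfl, hi, hj⟩ := ih h'
        exact ⟨i + 1, j, by omega, .step h hi, hj⟩
      | appRight _ hp h =>
        obtain ⟨i, j, rfl, hi, hj⟩ := ih h'
        exact ⟨i, j + 1, by omega, hi, .step h hj⟩
  · rintro ⟨i, j, rfl, ha, hb⟩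
    exact normIn_app ha hb

/-- The terms that normalise in exactly `k` steps. -/
def normSet (k : ℕ) : Set LTerm := {t | NormIn t k}

/-- The closures that reduce in one step to an element of `A`. -/
def closPre (A : Set LTerm) : Set LTerm :=
  {t | ∃ u s, t = .clos u s ∧ ∃ t', NStep t t' ∧ t' ∈ A}

/-- The closures that normalise in exactly `k` steps. -/
def closSet (k : ℕ) : Set LTerm := {t | ∃ u s, t = .clos u s ∧ NormIn t k}

theorem closSet_zero : closSet 0 = ∅ := by
  ext t
  simp only [closSet, mem_ofPred_eq, mem_empty_iff_false, iff_false]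
  rintro ⟨u, s, rfl, h⟩
  exact normIn_zero_iff.1 h

theorem closSet_succ (k : ℕ) : closSet (k + 1) = closPre (normSet k) := by
  simp only [closSet, closPre, normSet, normIn_succ_iff, mem_ofPred_eq]

/-! ### Disjoint unions of rectangles -/

/-- Finite disjoint unions of products of sets satisfying `P` with sets satisfying `Q`. -/
inductive IsRectUnion {α β : Type} (P : Set α → Prop) (Q : Set β → Prop) : Set (α × β) → Prop
  | empty : IsRectUnion P Q ∅
  | union {E F : Set (α × β)} : IsRectUnion P Q E → IsRectUnion P Q F → Disjoint E F →
      IsRectUnion P Q (E ∪ F)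
  | prod {A : Set α} {B : Set β} : P A → Q B → IsRectUnion P Q (A ×ˢ B)

theorem biUnion_of_disjoint_union {α ι : Type} {P : Set α → Prop} (h0 : P ∅)
    (hu : ∀ {A B}, P A → P B → Disjoint A B → P (A ∪ B)) (s : Finset ι) {f : ι → Set α}
    (hf : ∀ i ∈ s, P (f i)) (hd : ∀ i j, i ≠ j → Disjoint (f i) (f j)) :
    P (⋃ i ∈ s, f i) := by
  classical
  induction s using Finset.induction_on with
  | empty => simpa using h0
  | insert i s hi ih =>
    rw [Finset.set_biUnion_insert]
    refine hu (hf i (by simp)) (ih fun j hj => hf j (by simp [hj])) ?_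
    simp only [disjoint_iUnion_right]
    exact fun j hj => hd i j (by rintro rfl; exact hi hj)

/-- Transport of a disjoint union of rectangles along a relation that is functional from
right to left. -/
theorem IsRectUnion.transport {α β γ : Type} {P : Set α → Prop} {Q : Set β → Prop}
    {Z : Set γ → Prop} (h0 : Z ∅) (hu : ∀ {A B}, Z A → Z B → Disjoint A B → Z (A ∪ B))
    (r : α × β → γ → Prop) (hr : ∀ {p q x}, r p x → r q x → p = q)
    (hp : ∀ {A B}, P A → Q B → Z {x | ∃ p ∈ A ×ˢ B, r p x})
    {E : Set (α × β)} (hE : IsRectUnion P Q E) : Z {x | ∃ p ∈ E, r p x} := by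
  induction hE with
  | empty => simpa using h0
  | @union E F _ _ hd ihE ihF =>
    have : {x | ∃ p ∈ E ∪ F, r p x} = {x | ∃ p ∈ E, r p x} ∪ {x | ∃ p ∈ F, r p x} := by
      ext x
      simp only [mem_ofPred_eq, mem_union, or_and_right, exists_or]
    rw [this]
    refine hu ihE ihF (disjoint_left.2 ?_)
    rintro x ⟨p, hpE, hpx⟩ ⟨q, hqF, hqx⟩
    obtain rfl := hr hpx hqx
    exact disjoint_left.1 hd hpE hqF
  | prod hA hB => exact hp hA hB

/-- Sets of naturals containing either almost all naturals or almost none. -/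
def EventuallyConst (M : Set ℕ) : Prop := ∃ c, ∀ n ≥ c, (n ∈ M ↔ c ∈ M)

namespace EventuallyConst

theorem empty : EventuallyConst ∅ := ⟨0, by simp⟩

theorem univ : EventuallyConst univ := ⟨0, by simp⟩

theorem inter {M M' : Set ℕ} (h : EventuallyConst M) (h' : EventuallyConst M') :
    EventuallyConst (M ∩ M') := by
  obtain ⟨c, hc⟩ := h
  obtain ⟨c', hc'⟩ := h'
  refine ⟨max c c', fun n hn => ?_⟩
  rw [mem_inter_iff, mem_inter_iff, hc n (by omega), hc' n (by omega), hc (max c c') (by omega),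
    hc' (max c c') (by omega)]

theorem union {M M' : Set ℕ} (h : EventuallyConst M) (h' : EventuallyConst M') :
    EventuallyConst (M ∪ M') := by
  obtain ⟨c, hc⟩ := h
  obtain ⟨c', hc'⟩ := h'
  refine ⟨max c c', fun n hn => ?_⟩
  rw [mem_union, mem_union, hc n (by omega), hc' n (by omega), hc (max c c') (by omega),
    hc' (max c c') (by omega)]

theorem preimage_succ {M : Set ℕ} (h : EventuallyConst M) :
    EventuallyConst {n | n + 1 ∈ M} := by
  obtain ⟨c, hc⟩ := h
  refine ⟨c, fun n hn => ?_⟩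
  rw [mem_ofPred_eq, mem_ofPred_eq, hc (n + 1) (by omega), hc (c + 1) (by omega)]

theorem image_succ {M : Set ℕ} (h : EventuallyConst M) :
    EventuallyConst (Nat.succ '' M) := by
  obtain ⟨c, hc⟩ := h
  refine ⟨c + 1, fun n hn => ?_⟩
  obtain ⟨n, rfl⟩ : ∃ m, n = m + 1 := ⟨n - 1, by omega⟩
  simpa using hc n (by omega)

theorem singleton_zero : EventuallyConst {0} := ⟨1, fun n hn => by simp; omega⟩

end EventuallyConst

/-! ### Regular sets -/

/-- Terms (`true`) and substitutions (`false`). -/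
abbrev Obj : Bool → Type
  | true => LTerm
  | false => LSub

/-- The sets obtained as finite disjoint unions of patterns over the sets of all terms, all
substitutions and the terms that normalise in exactly `j` steps with `j < k`. -/
inductive Regular (k : ℕ) : (b : Bool) → Set (Obj b) → Prop
  | empty (b : Bool) : Regular k b ∅
  | union {b : Bool} {A B : Set (Obj b)} : Regular k b A → Regular k b B → Disjoint A B →
      Regular k b (A ∪ B)
  | univ (b : Bool) : Regular k b univ
  | norm (j : ℕ) : j < k → (∀ i ≤ j, Regular k true (closSet i)) → Regular k true (normSet j)
  | idx {M : Set ℕ} : EventuallyConst M → Regular k true (LTerm.idx '' M)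
  | lam {A : Set LTerm} : Regular k true A → Regular k true (LTerm.lam '' A)
  | app {A B : Set LTerm} : Regular k true A → Regular k true B →
      Regular k true (image2 LTerm.app A B)
  | clos {A : Set LTerm} {B : Set LSub} : Regular k true A → Regular k false B →
      Regular k true (image2 LTerm.clos A B)
  | slash {A : Set LTerm} : Regular k true A → Regular k false (LSub.slash '' A)
  | lift {B : Set LSub} : Regular k false B → Regular k false (LSub.lift '' B)
  | shift : Regular k false {LSub.shift}

theorem Regular.mono {k k' : ℕ} (hk : k ≤ k') {b : Bool} {A : Set (Obj b)}
    (h : Regular k b A) : Regular k' b A := by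
  induction h with
  | empty b => exact .empty b
  | union _ _ hd ihA ihB => exact .union ihA ihB hd
  | univ b => exact .univ b
  | norm j hj _ ih => exact .norm j (by omega) ih
  | idx hM => exact .idx hM
  | lam _ ih => exact .lam ih
  | app _ _ ihA ihB => exact .app ihA ihB
  | clos _ _ ihA ihB => exact .clos ihA ihB
  | slash _ ih => exact .slash ih
  | lift _ ih => exact .lift ih
  | shift => exact .shift

theorem Regular.term_induction {k : ℕ} {P : Set LTerm → Prop} (empty : P ∅)
    (union : ∀ {A B : Set LTerm}, P A → P B → Disjoint A B → P (A ∪ B)) (univ : P Set.univ)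
    (norm : ∀ j < k, (∀ i ≤ j, Regular k true (closSet i)) → (∀ i ≤ j, P (closSet i)) →
      P (normSet j))
    (idx : ∀ {M : Set ℕ}, EventuallyConst M → P (LTerm.idx '' M))
    (lam : ∀ {A : Set LTerm}, Regular k true A → P A → P (LTerm.lam '' A))
    (app : ∀ {A B : Set LTerm}, Regular k true A → Regular k true B → P A → P B →
      P (image2 LTerm.app A B))
    (clos : ∀ {A : Set LTerm} {B : Set LSub}, Regular k true A → Regular k false B → P A →
      P (image2 LTerm.clos A B))
    {A : Set LTerm} (h : Regular k true A) : P A := by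
  have key : ∀ {b : Bool} {A : Set (Obj b)}, Regular k b A →
      (match b, A with
        | true, A => P A
        | false, _ => True) := by
    intro b A h
    induction h with
    | empty b => cases b <;> trivial
    | @union b _ _ _ _ hd ihA ihB =>
      cases b
      · trivial
      · exact union ihA ihB hd
    | univ b => cases b <;> trivial
    | norm j hj h ih => exact norm j hj h ih
    | idx hM => exact idx hM
    | lam h ih => exact lam h ih
    | app hA hB ihA ihB => exact app hA hB ihA ihB
    | clos hA hB ihA _ => exact clos hA hB ihA
    | slash => trivial
    | lift => trivial
    | shift => trivial
  exact key h

theorem Regular.sub_induction {k : ℕ} {P : Set LSub → Prop} (empty : P ∅)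
    (union : ∀ {A B : Set LSub}, P A → P B → Disjoint A B → P (A ∪ B)) (univ : P Set.univ)
    (slash : ∀ {A : Set LTerm}, Regular k true A → P (LSub.slash '' A))
    (lift : ∀ {B : Set LSub}, Regular k false B → P (LSub.lift '' B))
    (shift : P {LSub.shift}) {B : Set LSub} (h : Regular k false B) : P B := by
  have key : ∀ {b : Bool} {A : Set (Obj b)}, Regular k b A →
      (match b, A with
        | true, _ => True
        | false, B => P B) := by
    intro b A h
    induction h with
    | empty b => cases b <;> trivial
    | @union b _ _ _ _ hd ihA ihB =>
      cases b
      · exact union ihA ihB hd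
      · trivial
    | univ b => cases b <;> trivial
    | slash h => exact slash h
    | lift h => exact lift h
    | shift => exact shift
    | _ => trivial
  exact key h

section Decomposition

variable {k : ℕ}

theorem Regular.slash_preimage {B : Set LSub} (h : Regular k false B) :
    Regular k true (LSub.slash ⁻¹' B) := by
  refine Regular.sub_induction (P := fun B => Regular k true (LSub.slash ⁻¹' B))
    (.empty _) (fun hA hB hd => ?_) (.univ _) (fun h => ?_) (fun _ => ?_) ?_ h
  · exact .union hA hB (hd.preimage _)
  · rwa [preimage_image_eq _ fun _ _ h => LSub.slash.inj h]
  · convert Regular.empty (k := k) true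
    ext; simp
  · convert Regular.empty (k := k) true
    ext; simp

theorem Regular.lift_preimage {B : Set LSub} (h : Regular k false B) :
    Regular k false (LSub.lift ⁻¹' B) := by
  refine Regular.sub_induction (P := fun B => Regular k false (LSub.lift ⁻¹' B))
    (.empty _) (fun hA hB hd => ?_) (.univ _) (fun h => ?_) (fun h => ?_) ?_ h
  · exact .union hA hB (hd.preimage _)
  · convert Regular.empty (k := k) false
    ext; simp
  · rwa [preimage_image_eq _ fun _ _ h => LSub.lift.inj h]
  · convert Regular.empty (k := k) false
    ext; simp

theorem Regular.idx_preimage {A : Set LTerm} (h : Regular k true A) :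
    EventuallyConst (LTerm.idx ⁻¹' A) := by
  refine Regular.term_induction (P := fun A => EventuallyConst (LTerm.idx ⁻¹' A))
    .empty (fun hA hB _ => hA.union hB) .univ (fun j _ _ _ => ?_) (fun h => ?_)
    (fun _ _ => ?_) (fun _ _ _ _ => ?_) (fun _ _ _ => ?_) h
  · simp only [normSet, preimage_ofPred_eq, normIn_idx_iff]
    by_cases hj : j = 0
    · simpa [hj] using EventuallyConst.univ
    · simpa [hj] using EventuallyConst.empty
  · rwa [preimage_image_eq _ fun _ _ h => LTerm.idx.inj h]
  all_goals
    convert EventuallyConst.empty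
    ext; simp

theorem Regular.lam_preimage {A : Set LTerm} (h : Regular k true A) :
    Regular k true (LTerm.lam ⁻¹' A) := by
  refine Regular.term_induction (P := fun A => Regular k true (LTerm.lam ⁻¹' A))
    (.empty _) (fun hA hB hd => .union hA hB (hd.preimage _)) (.univ _)
    (fun j hj hD _ => ?_) (fun _ => ?_) (fun h _ => ?_) (fun _ _ _ _ => ?_) (fun _ _ _ => ?_) h
  · simpa only [normSet, preimage_ofPred_eq, normIn_lam_iff] using Regular.norm j hj hD
  · convert Regular.empty (k := k) true
    ext; simp
  · rwa [preimage_image_eq _ fun _ _ h => LTerm.lam.inj h]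
  all_goals
    convert Regular.empty (k := k) true
    ext; simp

theorem Regular.app_preimage {A : Set LTerm} (h : Regular k true A) :
    IsRectUnion (Regular k true) (Regular k true) {p : LTerm × LTerm | .app p.1 p.2 ∈ A} := by
  refine Regular.term_induction
    (P := fun A => IsRectUnion (Regular k true) (Regular k true)
      {p : LTerm × LTerm | .app p.1 p.2 ∈ A})
    .empty (fun hA hB hd => ?_) ?_ (fun j hj hD _ => ?_) (fun _ => ?_) (fun _ _ => ?_)
    (fun hA hB _ _ => ?_) (fun _ _ _ => ?_) h
  · exact .union hA hB (hd.preimage fun p : LTerm × LTerm => LTerm.app p.1 p.2)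
  · convert IsRectUnion.prod (Regular.univ (k := k) true) (Regular.univ (k := k) true)
    ext; simp
  · have hn : ∀ i ≤ j, Regular k true (normSet i) := fun i hi =>
      .norm i (by omega) fun l hl => hD l (by omega)
    have : {p : LTerm × LTerm | .app p.1 p.2 ∈ normSet j} =
        ⋃ i ∈ Finset.range (j + 1), normSet i ×ˢ normSet (j - i) := by
      ext p
      simp only [normSet, mem_ofPred_eq, normIn_app_iff, mem_iUnion, Finset.mem_range, mem_prod]
      constructor
      · rintro ⟨i, l, rfl, h⟩
        exact ⟨i, by omega, by simpa using h⟩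
      · rintro ⟨i, hi, h⟩
        exact ⟨i, j - i, by omega, h⟩
    rw [this]
    refine biUnion_of_disjoint_union (P := IsRectUnion (Regular k true) (Regular k true))
      .empty .union _ (fun i hi => ?_) fun i l hil => ?_
    · rw [Finset.mem_range] at hi
      exact .prod (hn i (by omega)) (hn (j - i) (by omega))
    · exact disjoint_left.2 fun p hp hq => hil (normIn_unique hp.1 hq.1)
  · convert IsRectUnion.empty
    ext; simp
  · convert IsRectUnion.empty
    ext; simp
  · convert IsRectUnion.prod hA hB
    ext; simp
  · convert IsRectUnion.empty
    ext; simp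

theorem Regular.clos_preimage {A : Set LTerm} (h : Regular k true A) :
    IsRectUnion (Regular k true) (Regular k false) {p : LTerm × LSub | .clos p.1 p.2 ∈ A} := by
  refine Regular.term_induction
    (P := fun A => IsRectUnion (Regular k true) (Regular k false)
      {p : LTerm × LSub | .clos p.1 p.2 ∈ A})
    .empty (fun hA hB hd => ?_) ?_ (fun j hj hD ih => ?_) (fun _ => ?_) (fun _ _ => ?_)
    (fun _ _ _ _ => ?_) (fun hA hB _ => ?_) h
  · exact .union hA hB (hd.preimage fun p : LTerm × LSub => LTerm.clos p.1 p.2)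
  · convert IsRectUnion.prod (Regular.univ (k := k) true) (Regular.univ (k := k) false)
    ext; simp
  · simpa [closSet, normSet] using ih j le_rfl
  · convert IsRectUnion.empty
    ext; simp
  · convert IsRectUnion.empty
    ext; simp
  · convert IsRectUnion.empty
    ext; simp
  · convert IsRectUnion.prod hA hB
    ext; simp

/-! ### Intersections -/

theorem Regular.norm_inter {j : ℕ} (hj : j < k) (hD : ∀ i ≤ j, Regular k true (closSet i))
    (hI : ∀ i ≤ j, ∀ B, Regular k true B → Regular k true (closSet i ∩ B))
    {B : Set LTerm} (hB : Regular k true B) :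
    ∀ i ≤ j, Regular k true (normSet i ∩ B) := by
  have hn : ∀ i ≤ j, Regular k true (normSet i) := fun i hi =>
    .norm i (by omega) fun l hl => hD l (by omega)
  refine Regular.term_induction (P := fun B => ∀ i ≤ j, Regular k true (normSet i ∩ B))
    (fun i _ => ?_) (fun hA hB hd i hi => ?_) (fun i hi => ?_) (fun l hl hD' _ i hi => ?_)
    (fun {M} hM i hi => ?_) (fun {A} _ ih i hi => ?_) (fun {A B} _ _ ihA ihB i hi => ?_)
    (fun {A B} hA hB _ i hi => ?_) hB
  · simpa using Regular.empty (k := k) true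
  · rw [inter_union_distrib_left]
    exact .union (hA i hi) (hB i hi) (hd.mono inter_subset_right inter_subset_right)
  · simpa using hn i hi
  · by_cases h : i = l
    · subst h
      simpa using hn i hi
    · convert Regular.empty (k := k) true
      ext t
      simp only [mem_inter_iff, mem_empty_iff_false, iff_false]
      exact fun ht => h (normIn_unique ht.1 ht.2)
  · by_cases h : i = 0
    · convert Regular.idx (k := k) hM
      refine inter_eq_right.2 ?_
      rintro _ ⟨n, -, rfl⟩
      exact normIn_idx_iff.2 h
    · convert Regular.empty (k := k) true
      ext t
      simp only [mem_inter_iff, mem_empty_iff_false, iff_false]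
      rintro ⟨ht, n, -, rfl⟩
      exact h (normIn_idx_iff.1 ht)
  · convert Regular.lam (ih i hi)
    ext t
    constructor
    · rintro ⟨ht, a, ha, rfl⟩
      exact ⟨a, ⟨normIn_lam_iff.1 ht, ha⟩, rfl⟩
    · rintro ⟨a, ⟨ha, ha'⟩, rfl⟩
      exact ⟨normIn_lam_iff.2 ha, a, ha', rfl⟩
  · have : normSet i ∩ image2 LTerm.app A B = ⋃ l ∈ Finset.range (i + 1),
        image2 LTerm.app (normSet l ∩ A) (normSet (i - l) ∩ B) := by
      ext t
      simp only [mem_iUnion, Finset.mem_range]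
      constructor
      · rintro ⟨ht, a, ha, b, hb, rfl⟩
        obtain ⟨l, m, rfl, hl, hm⟩ := normIn_app_iff.1 ht
        exact ⟨l, by omega, a, ⟨hl, ha⟩, b, ⟨by rwa [Nat.add_sub_cancel_left], hb⟩, rfl⟩
      · rintro ⟨l, hl, a, ⟨ha, ha'⟩, b, ⟨hb, hb'⟩, rfl⟩
        exact ⟨normIn_app_iff.2 ⟨l, i - l, by omega, ha, hb⟩, a, ha', b, hb', rfl⟩
    rw [this]
    refine biUnion_of_disjoint_union (P := Regular k true) (.empty _) .union _
      (fun l hl => ?_) fun l m hlm => ?_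
    · rw [Finset.mem_range] at hl
      exact .app (ihA l (by omega)) (ihB (i - l) (by omega))
    · refine disjoint_left.2 ?_
      rintro _ ⟨a, ha, b, hb, rfl⟩ ⟨a', ha', b', hb', h⟩
      obtain ⟨rfl, rfl⟩ := LTerm.app.inj h
      exact hlm (normIn_unique ha.1 ha'.1)
  · convert hI i hi _ (.clos hA hB) using 1
    ext t
    constructor
    · rintro ⟨ht, a, ha, s, hs, rfl⟩
      exact ⟨⟨a, s, rfl, ht⟩, a, ha, s, hs, rfl⟩
    · rintro ⟨⟨_, _, _, ht⟩, h⟩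
      exact ⟨ht, h⟩

theorem Regular.inter {b : Bool} {A B : Set (Obj b)} (hA : Regular k b A)
    (hB : Regular k b B) : Regular k b (A ∩ B) := by
  induction hA with
  | empty b => simpa using Regular.empty b
  | union _ _ hd ihA ihB =>
    rw [union_inter_distrib_right]
    exact .union (ihA hB) (ihB hB) (hd.mono inter_subset_left inter_subset_left)
  | univ b => simpa using hB
  | norm j hj hD ih => exact norm_inter hj hD (fun i hi _ hB => ih i hi hB) hB j le_rfl
  | @idx M hM =>
    rw [← image_inter_preimage]
    exact .idx (hM.inter hB.idx_preimage)
  | lam _ ih =>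
    rw [← image_inter_preimage]
    exact .lam (ih hB.lam_preimage)
  | @app A A' _ _ ihA ihA' =>
    convert hB.app_preimage.transport (Regular.empty (k := k) true) Regular.union
      (fun p x => x = .app p.1 p.2 ∧ p.1 ∈ A ∧ p.2 ∈ A') ?_ ?_ using 1
    · ext t
      constructor
      · rintro ⟨⟨a, ha, a', ha', rfl⟩, ht⟩
        exact ⟨(a, a'), ht, rfl, ha, ha'⟩
      · rintro ⟨⟨a, a'⟩, ht, rfl, ha, ha'⟩
        exact ⟨⟨a, ha, a', ha', rfl⟩, ht⟩
    · rintro ⟨a, b⟩ ⟨c, d⟩ x ⟨rfl, -⟩ ⟨h, -⟩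
      simpa using h
    · intro C D hC hD
      convert Regular.app (ihA hC) (ihA' hD) using 1
      ext t
      constructor
      · rintro ⟨⟨a, a'⟩, ⟨h, h'⟩, rfl, ha, ha'⟩
        exact ⟨a, ⟨ha, h⟩, a', ⟨ha', h'⟩, rfl⟩
      · rintro ⟨a, ⟨ha, h⟩, a', ⟨ha', h'⟩, rfl⟩
        exact ⟨(a, a'), ⟨h, h'⟩, rfl, ha, ha'⟩
  | @clos A S _ _ ihA ihS =>
    convert hB.clos_preimage.transport (Regular.empty (k := k) true) Regular.union
      (fun p x => x = .clos p.1 p.2 ∧ p.1 ∈ A ∧ p.2 ∈ S) ?_ ?_ using 1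
    · ext t
      constructor
      · rintro ⟨⟨a, ha, s, hs, rfl⟩, ht⟩
        exact ⟨(a, s), ht, rfl, ha, hs⟩
      · rintro ⟨⟨a, s⟩, ht, rfl, ha, hs⟩
        exact ⟨⟨a, ha, s, hs, rfl⟩, ht⟩
    · rintro ⟨a, b⟩ ⟨c, d⟩ x ⟨rfl, -⟩ ⟨h, -⟩
      simpa using h
    · intro C D hC hD
      convert Regular.clos (ihA hC) (ihS hD) using 1
      ext t
      constructor
      · rintro ⟨⟨a, s⟩, ⟨h, h'⟩, rfl, ha, hs⟩
        exact ⟨a, ⟨ha, h⟩, s, ⟨hs, h'⟩, rfl⟩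
      · rintro ⟨a, ⟨ha, h⟩, s, ⟨hs, h'⟩, rfl⟩
        exact ⟨(a, s), ⟨h, h'⟩, rfl, ha, hs⟩
  | slash _ ih =>
    rw [← image_inter_preimage]
    exact .slash (ih hB.slash_preimage)
  | lift _ ih =>
    rw [← image_inter_preimage]
    exact .lift (ih hB.lift_preimage)
  | shift =>
    by_cases h : LSub.shift ∈ B
    · convert Regular.shift (k := k)
      exact inter_eq_left.2 (singleton_subset_iff.2 h)
    · convert Regular.empty (k := k) false
      exact singleton_inter_eq_empty.2 h

end Decomposition

/-! ### Predecessors under a head step -/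

section Predecessor

variable {k : ℕ} {A : Set LTerm}

theorem Regular.app_clos_pre (hA : Regular k true A) :
    Regular k true {x | ∃ a b s, x = .clos (.app a b) s ∧ .app (.clos a s) (.clos b s) ∈ A} := by
  convert hA.app_preimage.transport (Regular.empty (k := k) true) Regular.union
    (fun p x => ∃ a b s, p = (.clos a s, .clos b s) ∧ x = .clos (.app a b) s) ?_ ?_ using 1
  · ext x
    constructor
    · rintro ⟨a, b, s, rfl, h⟩
      exact ⟨_, h, a, b, s, rfl, rfl⟩
    · rintro ⟨_, h, a, b, s, rfl, rfl⟩
      exact ⟨a, b, s, rfl, h⟩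
  · rintro _ _ _ ⟨a, b, s, rfl, rfl⟩ ⟨a', b', s', rfl, h⟩
    simp_all
  intro B C hB hC
  convert hB.clos_preimage.transport (Regular.empty (k := k) true) Regular.union
    (fun p x => ∃ b, x = .clos (.app p.1 b) p.2 ∧ .clos b p.2 ∈ C) ?_ ?_ using 1
  · ext x
    constructor
    · rintro ⟨_, ⟨h, h'⟩, a, b, s, rfl, rfl⟩
      exact ⟨(a, s), h, b, rfl, h'⟩
    · rintro ⟨⟨a, s⟩, h, b, rfl, h'⟩
      exact ⟨(.clos a s, .clos b s), ⟨h, h'⟩, a, b, s, rfl, rfl⟩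
  · rintro ⟨a, s⟩ ⟨a', s'⟩ _ ⟨b, rfl, -⟩ ⟨b', h, -⟩
    simp_all
  intro B' S hB' hS
  convert hC.clos_preimage.transport (Regular.empty (k := k) true) Regular.union
    (fun p x => ∃ a, x = .clos (.app a p.1) p.2 ∧ a ∈ B' ∧ p.2 ∈ S) ?_ ?_ using 1
  · ext x
    constructor
    · rintro ⟨⟨a, s⟩, ⟨h, h'⟩, b, rfl, hb⟩
      exact ⟨(b, s), hb, a, rfl, h, h'⟩
    · rintro ⟨⟨b, s⟩, hb, a, rfl, h, h'⟩
      exact ⟨(a, s), ⟨h, h'⟩, b, rfl, hb⟩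
  · rintro ⟨a, s⟩ ⟨a', s'⟩ _ ⟨b, rfl, -⟩ ⟨b', h, -⟩
    simp_all
  intro C' S' hC' hS'
  convert Regular.clos (.app hB' hC') (hS.inter hS') using 1
  ext x
  constructor
  · rintro ⟨⟨b, s⟩, ⟨hb, hs'⟩, a, rfl, ha, hs⟩
    exact ⟨_, ⟨a, ha, b, hb, rfl⟩, s, ⟨hs, hs'⟩, rfl⟩
  · rintro ⟨_, ⟨a, ha, b, hb, rfl⟩, s, ⟨hs, hs'⟩, rfl⟩
    exact ⟨(b, s), ⟨hb, hs'⟩, a, rfl, ha, hs⟩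

theorem Regular.lam_clos_pre (hA : Regular k true A) :
    Regular k true {x | ∃ a s, x = .clos (.lam a) s ∧ .lam (.clos a (.lift s)) ∈ A} := by
  convert hA.lam_preimage.clos_preimage.transport (Regular.empty (k := k) true) Regular.union
    (fun p x => ∃ s, p.2 = .lift s ∧ x = .clos (.lam p.1) s) ?_ ?_ using 1
  · ext x
    constructor
    · rintro ⟨a, s, rfl, h⟩
      exact ⟨(a, .lift s), h, s, rfl, rfl⟩
    · rintro ⟨⟨a, _⟩, h, s, rfl, rfl⟩
      exact ⟨a, s, rfl, h⟩
  · rintro ⟨a, s⟩ ⟨a', s'⟩ _ ⟨s, rfl, rfl⟩ ⟨s', rfl, h⟩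
    simp_all
  intro B S hB hS
  convert Regular.clos (.lam hB) hS.lift_preimage using 1
  ext x
  constructor
  · rintro ⟨⟨a, _⟩, ⟨ha, hs⟩, s, rfl, rfl⟩
    exact ⟨_, ⟨a, ha, rfl⟩, s, hs, rfl⟩
  · rintro ⟨_, ⟨a, ha, rfl⟩, s, hs, rfl⟩
    exact ⟨(a, .lift s), ⟨ha, hs⟩, s, rfl, rfl⟩

theorem Regular.zero_slash_pre (hA : Regular k true A) :
    Regular k true {x | ∃ a, x = .clos (.idx 0) (.slash a) ∧ a ∈ A} := by
  convert Regular.clos (.idx .singleton_zero) (.slash hA) using 1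
  ext x
  constructor
  · rintro ⟨a, rfl, h⟩
    exact ⟨_, ⟨0, rfl, rfl⟩, _, ⟨a, h, rfl⟩, rfl⟩
  · rintro ⟨_, ⟨_, rfl, rfl⟩, _, ⟨a, h, rfl⟩, rfl⟩
    exact ⟨a, rfl, h⟩

theorem Regular.succ_slash_pre (hA : Regular k true A) :
    Regular k true {x | ∃ n a, x = .clos (.idx (n + 1)) (.slash a) ∧ .idx n ∈ A} := by
  convert Regular.clos (.idx hA.idx_preimage.image_succ) (.slash (.univ (k := k) true)) using 1
  ext x
  constructor
  · rintro ⟨n, a, rfl, h⟩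
    exact ⟨_, ⟨_, ⟨n, h, rfl⟩, rfl⟩, _, ⟨a, trivial, rfl⟩, rfl⟩
  · rintro ⟨_, ⟨_, ⟨n, h, rfl⟩, rfl⟩, _, ⟨a, -, rfl⟩, rfl⟩
    exact ⟨n, a, rfl, h⟩

theorem Regular.zero_lift_pre (A : Set LTerm) :
    Regular k true {x | ∃ s, x = .clos (.idx 0) (.lift s) ∧ .idx 0 ∈ A} := by
  by_cases h0 : LTerm.idx 0 ∈ A
  · convert Regular.clos (.idx .singleton_zero) (.lift (.univ (k := k) false)) using 1
    ext x
    constructor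
    · rintro ⟨s, rfl, -⟩
      exact ⟨_, ⟨0, rfl, rfl⟩, _, ⟨s, trivial, rfl⟩, rfl⟩
    · rintro ⟨_, ⟨_, rfl, rfl⟩, _, ⟨s, -, rfl⟩, rfl⟩
      exact ⟨s, rfl, h0⟩
  · convert Regular.empty (k := k) true
    ext x
    simp [h0]

theorem Regular.succ_lift_pre (hA : Regular k true A) :
    Regular k true {x | ∃ n s, x = .clos (.idx (n + 1)) (.lift s) ∧
      .clos (.clos (.idx n) s) .shift ∈ A} := by
  convert hA.clos_preimage.transport (Regular.empty (k := k) true) Regular.union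
    (fun p x => ∃ n s, p = (.clos (.idx n) s, .shift) ∧ x = .clos (.idx (n + 1)) (.lift s))
    ?_ ?_ using 1
  · ext x
    constructor
    · rintro ⟨n, s, rfl, h⟩
      exact ⟨_, h, n, s, rfl, rfl⟩
    · rintro ⟨_, h, n, s, rfl, rfl⟩
      exact ⟨n, s, rfl, h⟩
  · rintro _ _ _ ⟨n, s, rfl, rfl⟩ ⟨n', s', rfl, h⟩
    simp_all
  intro B S hB _
  by_cases hshift : LSub.shift ∈ S
  · convert hB.clos_preimage.transport (Regular.empty (k := k) true) Regular.union
      (fun p x => ∃ n, p.1 = .idx n ∧ x = .clos (.idx (n + 1)) (.lift p.2)) ?_ ?_ using 1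
    · ext x
      constructor
      · rintro ⟨_, ⟨h, -⟩, n, s, rfl, rfl⟩
        exact ⟨(.idx n, s), h, n, rfl, rfl⟩
      · rintro ⟨⟨_, s⟩, h, n, rfl, rfl⟩
        exact ⟨(.clos (.idx n) s, .shift), ⟨h, hshift⟩, n, s, rfl, rfl⟩
    · rintro ⟨_, s⟩ ⟨_, s'⟩ _ ⟨n, rfl, rfl⟩ ⟨n', rfl, h⟩
      simp_all
    intro B' S' hB' hS'
    convert Regular.clos (.idx hB'.idx_preimage.image_succ) (.lift hS') using 1
    ext x
    constructor
    · rintro ⟨⟨_, s⟩, ⟨h, h'⟩, n, rfl, rfl⟩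
      exact ⟨_, ⟨_, ⟨n, h, rfl⟩, rfl⟩, _, ⟨s, h', rfl⟩, rfl⟩
    · rintro ⟨_, ⟨_, ⟨n, h, rfl⟩, rfl⟩, _, ⟨s, h', rfl⟩, rfl⟩
      exact ⟨(.idx n, s), ⟨h, h'⟩, n, rfl, rfl⟩
  · convert Regular.empty (k := k) true
    ext x
    simp only [mem_ofPred_eq, mem_empty_iff_false, iff_false]
    rintro ⟨_, ⟨-, h⟩, n, s, rfl, rfl⟩
    exact hshift h

theorem Regular.idx_shift_pre (hA : Regular k true A) :
    Regular k true {x | ∃ n, x = .clos (.idx n) .shift ∧ .idx (n + 1) ∈ A} := by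
  convert Regular.clos (.idx hA.idx_preimage.preimage_succ) (.shift (k := k)) using 1
  ext x
  constructor
  · rintro ⟨n, rfl, h⟩
    exact ⟨_, ⟨n, h, rfl⟩, _, rfl, rfl⟩
  · rintro ⟨_, ⟨n, h, rfl⟩, _, rfl, rfl⟩
    exact ⟨n, rfl, h⟩

/-- The closures whose body is a closure and which reduce in one step to an element of `A`. -/
def nestedPre (A : Set LTerm) : Set LTerm :=
  {x | ∃ u v s, x = .clos (.clos u v) s ∧ ∃ t, NStep (.clos u v) t ∧ .clos t s ∈ A}

theorem closPre_eq (A : Set LTerm) : closPre A =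
    {x | ∃ a b s, x = .clos (.app a b) s ∧ .app (.clos a s) (.clos b s) ∈ A} ∪
    ({x | ∃ a s, x = .clos (.lam a) s ∧ .lam (.clos a (.lift s)) ∈ A} ∪
    ({x | ∃ a, x = .clos (.idx 0) (.slash a) ∧ a ∈ A} ∪
    ({x | ∃ n a, x = .clos (.idx (n + 1)) (.slash a) ∧ .idx n ∈ A} ∪
    ({x | ∃ s, x = .clos (.idx 0) (.lift s) ∧ .idx 0 ∈ A} ∪
    ({x | ∃ n s, x = .clos (.idx (n + 1)) (.lift s) ∧
      .clos (.clos (.idx n) s) .shift ∈ A} ∪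
    ({x | ∃ n, x = .clos (.idx n) .shift ∧ .idx (n + 1) ∈ A} ∪ nestedPre A)))))) := by
  ext x
  constructor
  · rintro ⟨u, s, rfl, t, h, ht⟩
    cases h with
    | appS a b => exact .inl ⟨a, b, s, rfl, ht⟩
    | lamS a => exact .inr (.inl ⟨a, s, rfl, ht⟩)
    | fvar => exact .inr (.inr (.inl ⟨t, rfl, ht⟩))
    | rvar n a => exact .inr (.inr (.inr (.inl ⟨n, a, rfl, ht⟩)))
    | fvarLift s => exact .inr (.inr (.inr (.inr (.inl ⟨s, rfl, ht⟩))))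
    | rvarLift n s => exact .inr (.inr (.inr (.inr (.inr (.inl ⟨n, s, rfl, ht⟩)))))
    | varShift n => exact .inr (.inr (.inr (.inr (.inr (.inr (.inl ⟨n, rfl, ht⟩))))))
    | closCong _ hc h =>
      obtain ⟨u, v, rfl⟩ := hc
      exact .inr (.inr (.inr (.inr (.inr (.inr (.inr ⟨u, v, s, rfl, _, h, ht⟩))))))
  · rintro (⟨a, b, s, rfl, h⟩ | ⟨a, s, rfl, h⟩ | ⟨a, rfl, h⟩ | ⟨n, a, rfl, h⟩ | ⟨s, rfl, h⟩ |
      ⟨n, s, rfl, h⟩ | ⟨n, rfl, h⟩ | ⟨u, v, s, rfl, t, h, ht⟩)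
    · exact ⟨_, _, rfl, _, .appS a b s, h⟩
    · exact ⟨_, _, rfl, _, .lamS a s, h⟩
    · exact ⟨_, _, rfl, _, .fvar a, h⟩
    · exact ⟨_, _, rfl, _, .rvar n a, h⟩
    · exact ⟨_, _, rfl, _, .fvarLift s, h⟩
    · exact ⟨_, _, rfl, _, .rvarLift n s, h⟩
    · exact ⟨_, _, rfl, _, .varShift n, h⟩
    · exact ⟨_, _, rfl, _, .closCong s ⟨u, v, rfl⟩ h, ht⟩

theorem Regular.closPre_of_nestedPre (hA : Regular k true A)
    (hN : Regular k true (nestedPre A)) : Regular k true (closPre A) := by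
  rw [closPre_eq]
  refine .union hA.app_clos_pre (.union hA.lam_clos_pre (.union hA.zero_slash_pre
    (.union hA.succ_slash_pre (.union (zero_lift_pre A) (.union hA.succ_lift_pre
    (.union hA.idx_shift_pre hN ?_) ?_) ?_) ?_) ?_) ?_) ?_
  all_goals
    refine disjoint_left.2 fun x h h' => ?_
    simp only [PsiReduction.nestedPre, mem_union, mem_ofPred_eq] at h h'
    casesm* ∃ _, _, _ ∧ _, _ ∨ _ <;> simp_all

theorem Regular.nestedPre (hA : Regular k true A) : Regular k true (nestedPre A) := by
  refine Regular.term_induction (P := fun A => Regular k true (PsiReduction.nestedPre A))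
    ?_ (fun {A B} hA hB hd => ?_) ?_ (fun j hj hD ih => ?_) (fun _ => ?_) (fun _ _ => ?_)
    (fun _ _ _ _ => ?_) (fun {A S} hA hS ih => ?_) hA
  · simpa [PsiReduction.nestedPre] using Regular.empty (k := k) true
  · have : PsiReduction.nestedPre (A ∪ B) =
        PsiReduction.nestedPre A ∪ PsiReduction.nestedPre B := by
      ext x
      constructor
      · rintro ⟨u, v, s, rfl, t, h, ht | ht⟩
        exacts [.inl ⟨u, v, s, rfl, t, h, ht⟩, .inr ⟨u, v, s, rfl, t, h, ht⟩]
      · rintro (⟨u, v, s, rfl, t, h, ht⟩ | ⟨u, v, s, rfl, t, h, ht⟩)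
        exacts [⟨u, v, s, rfl, t, h, .inl ht⟩, ⟨u, v, s, rfl, t, h, .inr ht⟩]
    rw [this]
    refine .union hA hB (disjoint_left.2 ?_)
    rintro _ ⟨u, v, s, rfl, t, h, ht⟩ ⟨u', v', s', he, t', h', ht'⟩
    obtain ⟨⟨rfl, rfl⟩, rfl⟩ := by simpa using he
    obtain rfl := nStep_deterministic h h'
    exact disjoint_left.1 hd ht ht'
  · convert Regular.clos (.clos (.univ (k := k) true) (.univ false)) (.univ false) using 1
    ext x
    constructor
    · rintro ⟨u, v, s, rfl, -⟩
      exact ⟨_, ⟨u, trivial, v, trivial, rfl⟩, s, trivial, rfl⟩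
    · rintro ⟨_, ⟨u, -, v, -, rfl⟩, s, -, rfl⟩
      obtain ⟨t, ht⟩ := exists_nStep_clos u v
      exact ⟨u, v, s, rfl, t, ht, trivial⟩
  · convert ih j le_rfl using 1
    simp [PsiReduction.nestedPre, closSet, normSet]
  · convert Regular.empty (k := k) true
    ext; simp [PsiReduction.nestedPre]
  · convert Regular.empty (k := k) true
    ext; simp [PsiReduction.nestedPre]
  · convert Regular.empty (k := k) true
    ext; simp [PsiReduction.nestedPre]
  · convert Regular.clos (hA.closPre_of_nestedPre ih) hS using 1
    ext x
    constructor
    · rintro ⟨u, v, s, rfl, t, h, _, ht, _, hs, he⟩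
      obtain ⟨rfl, rfl⟩ := LTerm.clos.inj he
      exact ⟨_, ⟨u, v, rfl, _, h, ht⟩, _, hs, rfl⟩
    · rintro ⟨_, ⟨u, v, rfl, t, h, ht⟩, s, hs, rfl⟩
      exact ⟨u, v, s, rfl, t, h, t, ht, s, hs, rfl⟩

theorem Regular.closPre (hA : Regular k true A) : Regular k true (closPre A) :=
  hA.closPre_of_nestedPre hA.nestedPre

theorem regular_closSet (k : ℕ) : Regular k true (closSet k) := by
  induction k using Nat.strong_induction_on with
  | _ k ih =>
    cases k with
    | zero => simpa only [closSet_zero] using Regular.empty true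
    | succ k =>
      rw [closSet_succ]
      exact .closPre (.norm k (by omega) fun i hi => (ih i (by omega)).mono (by omega))

end Predecessor

/-! ### Generating functions -/

section GeneratingFunction

open PowerSeries

variable {α β γ : Type} {w : α → ℕ} {w' : β → ℕ} {v : γ → ℕ}

/-- The generating function of the set `A` with respect to the size function `w`. -/
noncomputable def genFun (w : α → ℕ) (A : Set α) : PowerSeries ℝ :=
  PowerSeries.mk fun n => (({x ∈ A | w x = n}.ncard : ℕ) : ℝ)

theorem genFun_empty : genFun w ∅ = 0 := by
  ext n
  simp [genFun]

theorem genFun_union (hw : ∀ n, {x | w x = n}.Finite) {A B : Set α} (h : Disjoint A B) :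
    genFun w (A ∪ B) = genFun w A + genFun w B := by
  ext n
  have hU : {x ∈ A ∪ B | w x = n} = {x ∈ A | w x = n} ∪ {x ∈ B | w x = n} := by
    ext x
    simp only [mem_ofPred_eq, mem_union, or_and_right]
  simp only [genFun, coeff_mk, map_add, hU]
  rw [ncard_union_eq (h.mono (fun _ hx => hx.1) (fun _ hx => hx.1))
    ((hw n).subset fun _ hx => hx.2) ((hw n).subset fun _ hx => hx.2), Nat.cast_add]

theorem genFun_biUnion {ι : Type} (hw : ∀ n, {x | w x = n}.Finite) (s : Finset ι)
    {f : ι → Set α} (hd : ∀ i j, i ≠ j → Disjoint (f i) (f j)) :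
    genFun w (⋃ i ∈ s, f i) = ∑ i ∈ s, genFun w (f i) := by
  classical
  induction s using Finset.induction_on with
  | empty => simp [genFun_empty]
  | insert i s hi ih =>
    rw [Finset.set_biUnion_insert, genFun_union hw, ih, Finset.sum_insert hi]
    simp only [disjoint_iUnion_right]
    exact fun j hj => hd i j (by rintro rfl; exact hi hj)

theorem genFun_image {f : α → γ} (hf : f.Injective) (hs : ∀ x, v (f x) = w x) (A : Set α) :
    genFun v (f '' A) = genFun w A := by
  ext n
  have : {x ∈ f '' A | v x = n} = f '' {x ∈ A | w x = n} := by
    ext x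
    constructor
    · rintro ⟨⟨a, ha, rfl⟩, h⟩
      exact ⟨a, ⟨ha, by rw [← hs, h]⟩, rfl⟩
    · rintro ⟨a, ⟨ha, h⟩, rfl⟩
      exact ⟨⟨a, ha, rfl⟩, by rw [hs, h]⟩
  simp only [genFun, coeff_mk, this, ncard_image_of_injective _ hf]

theorem genFun_add_one (A : Set α) : genFun (fun x => w x + 1) A = X * genFun w A := by
  ext n
  cases n with
  | zero => simp [genFun]
  | succ n => simp [genFun, coeff_succ_X_mul]

theorem genFun_image_add_one {f : α → γ} (hf : f.Injective) (hs : ∀ x, v (f x) = w x + 1)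
    (A : Set α) : genFun v (f '' A) = X * genFun w A := by
  rw [genFun_image hf hs, genFun_add_one]

theorem genFun_prod (hw : ∀ n, {x | w x = n}.Finite) (hw' : ∀ n, {x | w' x = n}.Finite)
    (A : Set α) (B : Set β) :
    genFun (fun p : α × β => w p.1 + w' p.2) (A ×ˢ B) = genFun w A * genFun w' B := by
  classical
  ext n
  simp only [genFun, coeff_mk, coeff_mul]
  have hA : ∀ n, {x ∈ A | w x = n}.Finite := fun n => (hw n).subset fun _ hx => hx.2
  have hB : ∀ n, {x ∈ B | w' x = n}.Finite := fun n => (hw' n).subset fun _ hx => hx.2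
  have hU : {p ∈ A ×ˢ B | w p.1 + w' p.2 = n} = ((Finset.HasAntidiagonal.antidiagonal n).biUnion fun ij =>
      (hA ij.1).toFinset ×ˢ (hB ij.2).toFinset : Finset (α × β)) := by
    ext ⟨a, b⟩
    simp only [mem_ofPred_eq, mem_prod, Finset.coe_biUnion, Finset.coe_product, mem_iUnion,
      Finite.coe_toFinset, Finset.mem_coe,
      Finset.HasAntidiagonal.mem_antidiagonal, exists_prop]
    constructor
    · rintro ⟨⟨ha, hb⟩, h⟩
      exact ⟨(w a, w' b), h, ⟨ha, rfl⟩, hb, rfl⟩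
    · rintro ⟨⟨i, j⟩, h, ⟨ha, rfl⟩, hb, rfl⟩
      exact ⟨⟨ha, hb⟩, h⟩
  rw [hU, ncard_coe_finset, Finset.card_biUnion, Nat.cast_sum]
  · refine Finset.sum_congr rfl fun ij _ => ?_
    rw [Finset.card_product, Nat.cast_mul, ncard_eq_toFinset_card _ (hA _),
      ncard_eq_toFinset_card _ (hB _)]
  · rintro ⟨i, j⟩ _ ⟨i', j'⟩ _ hne
    refine Finset.disjoint_left.2 ?_
    rintro ⟨a, b⟩ h h'
    simp only [Finset.mem_product, Finite.mem_toFinset, mem_ofPred_eq] at h h'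
    exact hne (by rw [← h.1.2, ← h.2.2, h'.1.2, h'.2.2])

theorem genFun_image2 {f : α → β → γ} (hf : Function.Injective2 f)
    (hs : ∀ a b, v (f a b) = w a + w' b + 1) (hw : ∀ n, {x | w x = n}.Finite)
    (hw' : ∀ n, {x | w' x = n}.Finite) (A : Set α) (B : Set β) :
    genFun v (image2 f A B) = X * (genFun w A * genFun w' B) := by
  rw [← image_prod, genFun_image_add_one (f := fun p : α × β => f p.1 p.2)
    (fun p q h => Prod.ext_iff.2 (hf h)) (fun p => hs p.1 p.2), genFun_prod hw hw']

theorem genFun_singleton (x : α) : genFun w {x} = X ^ w x := by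
  ext n
  rw [genFun, coeff_mk, coeff_X_pow]
  split_ifs with h
  · have : {y ∈ ({x} : Set α) | w y = n} = {x} := by
      ext y
      simp only [mem_ofPred_eq, mem_singleton_iff, and_iff_left_iff_imp]
      rintro rfl
      exact h.symm
    rw [this, ncard_singleton, Nat.cast_one]
  · have : {y ∈ ({x} : Set α) | w y = n} = ∅ := by
      ext y
      simp only [mem_ofPred_eq, mem_singleton_iff, mem_empty_iff_false, iff_false]
      rintro ⟨rfl, h'⟩
      exact h h'.symm
    rw [this, ncard_empty, Nat.cast_zero]

end GeneratingFunction

theorem finite_size_le (n : ℕ) :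
    {t : LTerm | t.size ≤ n}.Finite ∧ {s : LSub | s.size ≤ n}.Finite := by
  induction n with
  | zero =>
    constructor
    · convert finite_empty
      ext t
      cases t <;> simp [LTerm.size]
    · convert finite_empty
      ext s
      cases s <;> simp [LSub.size]
  | succ n ih =>
    obtain ⟨hT, hS⟩ := ih
    constructor
    · refine ((((finite_Iic n).image LTerm.idx).union (hT.image LTerm.lam)).union
        ((hT.image2 LTerm.app hT).union (hT.image2 LTerm.clos hS))).subset ?_
      rintro (m | a | ⟨a, b⟩ | ⟨a, s⟩) h <;> simp only [LTerm.size, mem_ofPred_eq] at h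
      · exact .inl (.inl ⟨m, by simp only [mem_Iic]; omega, rfl⟩)
      · exact .inl (.inr ⟨a, by simp only [mem_ofPred_eq]; omega, rfl⟩)
      · exact .inr (.inl ⟨a, by simp only [mem_ofPred_eq]; omega, b,
          by simp only [mem_ofPred_eq]; omega, rfl⟩)
      · exact .inr (.inr ⟨a, by simp only [mem_ofPred_eq]; omega, s,
          by simp only [mem_ofPred_eq]; omega, rfl⟩)
    · refine (((hT.image LSub.slash).union (hS.image LSub.lift)).union
        (finite_singleton LSub.shift)).subset ?_
      rintro (a | s | _) h <;> simp only [LSub.size, mem_ofPred_eq] at h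
      · exact .inl (.inl ⟨a, by simp only [mem_ofPred_eq]; omega, rfl⟩)
      · exact .inl (.inr ⟨s, by simp only [mem_ofPred_eq]; omega, rfl⟩)
      · exact .inr rfl

theorem finite_term_size_eq (n : ℕ) : {t : LTerm | t.size = n}.Finite :=
  (finite_size_le n).1.subset fun _ h => le_of_eq h

theorem finite_sub_size_eq (n : ℕ) : {s : LSub | s.size = n}.Finite :=
  (finite_size_le n).2.subset fun _ h => le_of_eq h

theorem genFun_normSet (k : ℕ) : genFun LTerm.size (normSet k) = Gps k := by
  ext n
  simp only [genFun, Gps, PowerSeries.coeff_mk, normSet, mem_ofPred_eq, and_comm]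
  rfl

theorem genFun_term_univ : genFun LTerm.size univ = Tps := by
  ext n
  simp only [genFun, Tps, PowerSeries.coeff_mk, mem_univ, true_and]
  rfl

theorem genFun_sub_univ : genFun LSub.size univ = Sps := by
  ext n
  simp only [genFun, Sps, PowerSeries.coeff_mk, mem_univ, true_and]
  rfl

theorem genFun_nat_univ : genFun (fun m : ℕ => m + 1) univ = Nps := by
  ext n
  simp only [genFun, Nps, PowerSeries.coeff_mk, mem_univ, true_and]
  rfl

/-- The semiring generated by `z`, `T`, `S`, `N` and the `G_j` with `j < k`. -/
noncomputable def patternSemiring (k : ℕ) : Subsemiring (PowerSeries ℝ) :=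
  Subsemiring.closure ({PowerSeries.X, Tps, Sps, Nps} ∪ Gps '' Iio k)

section PatternSemiring

variable {k : ℕ}

theorem X_mem : PowerSeries.X ∈ patternSemiring k := Subsemiring.subset_closure (by simp)

theorem Tps_mem : Tps ∈ patternSemiring k := Subsemiring.subset_closure (by simp)

theorem Sps_mem : Sps ∈ patternSemiring k := Subsemiring.subset_closure (by simp)

theorem Nps_mem : Nps ∈ patternSemiring k := Subsemiring.subset_closure (by simp)

theorem Gps_mem {j : ℕ} (hj : j < k) : Gps j ∈ patternSemiring k :=
  Subsemiring.subset_closure (.inr ⟨j, hj, rfl⟩)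

theorem EventuallyConst.genFun_mem {M : Set ℕ} (hM : EventuallyConst M) :
    genFun (fun m : ℕ => m + 1) M ∈ patternSemiring k := by
  obtain ⟨c, hc⟩ := hM
  induction c generalizing M with
  | zero =>
    by_cases h0 : 0 ∈ M
    · convert Nps_mem (k := k)
      rw [← genFun_nat_univ]
      congr
      exact eq_univ_of_forall fun n => (hc n (by omega)).2 h0
    · convert zero_mem (patternSemiring k)
      rw [← genFun_empty]
      congr
      exact eq_empty_of_forall_notMem fun n hn => h0 ((hc n (by omega)).1 hn)
  | succ c ih =>
    have hfin : ∀ n, {m : ℕ | m + 1 = n}.Finite := fun n =>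
      (finite_Iic n).subset fun m (hm : m + 1 = n) => by simp only [mem_Iic]; omega
    have hsplit : M = (Nat.succ '' {n | n + 1 ∈ M}) ∪ (M ∩ {0}) := by
      ext n
      cases n <;> simp
    have hshift : genFun (fun m : ℕ => m + 1) {n | n + 1 ∈ M} ∈ patternSemiring k :=
      ih fun n hn => hc (n + 1) (by omega)
    rw [hsplit, genFun_union hfin, genFun_image_add_one Nat.succ_injective fun _ => rfl]
    · refine add_mem (mul_mem X_mem hshift) ?_
      by_cases h0 : 0 ∈ M
      · rw [inter_eq_right.2 (singleton_subset_iff.2 h0), genFun_singleton]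
        exact pow_mem X_mem _
      · rw [inter_singleton_eq_empty.2 h0, genFun_empty]
        exact zero_mem _
    · refine disjoint_left.2 ?_
      rintro _ ⟨n, -, rfl⟩ ⟨-, h⟩
      exact Nat.succ_ne_zero n h

/-- The size of a term or of a substitution. -/
def objSize : (b : Bool) → Obj b → ℕ
  | true => LTerm.size
  | false => LSub.size

theorem finite_objSize_eq : ∀ (b : Bool) (n : ℕ), {x | objSize b x = n}.Finite
  | true => finite_term_size_eq
  | false => finite_sub_size_eq

theorem genFun_app (A B : Set LTerm) : genFun LTerm.size (image2 LTerm.app A B) =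
    PowerSeries.X * (genFun LTerm.size A * genFun LTerm.size B) :=
  genFun_image2 (fun _ _ _ _ h => LTerm.app.inj h)
    (fun _ _ => by simp only [LTerm.size]; omega) finite_term_size_eq finite_term_size_eq A B

theorem genFun_lam (A : Set LTerm) :
    genFun LTerm.size (LTerm.lam '' A) = PowerSeries.X * genFun LTerm.size A :=
  genFun_image_add_one (fun _ _ h => LTerm.lam.inj h)
    (fun _ => by simp only [LTerm.size]; omega) A

theorem Regular.genFun_mem {b : Bool} {A : Set (Obj b)} (h : Regular k b A) :
    genFun (objSize b) A ∈ patternSemiring k := by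
  induction h with
  | empty b =>
    rw [genFun_empty]
    exact zero_mem _
  | union _ _ hd ihA ihB =>
    rw [genFun_union (finite_objSize_eq _) hd]
    exact add_mem ihA ihB
  | univ b =>
    cases b
    · exact genFun_sub_univ ▸ Sps_mem
    · exact genFun_term_univ ▸ Tps_mem
  | norm j hj _ _ => exact genFun_normSet j ▸ Gps_mem hj
  | @idx M hM =>
    have := genFun_image (v := LTerm.size) (w := fun m : ℕ => m + 1)
      (fun _ _ h => LTerm.idx.inj h) (fun _ => by simp only [LTerm.size]) M
    exact this ▸ hM.genFun_mem
  | @lam A _ ih => exact genFun_lam A ▸ mul_mem X_mem ih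
  | @app A B _ _ ihA ihB => exact genFun_app A B ▸ mul_mem X_mem (mul_mem ihA ihB)
  | @clos A B _ _ ihA ihB =>
    have := genFun_image2 (v := LTerm.size) (w := LTerm.size) (w' := LSub.size)
      (fun _ _ _ _ h => LTerm.clos.inj h) (fun _ _ => by simp only [LTerm.size]; omega)
      finite_term_size_eq finite_sub_size_eq A B
    exact this ▸ mul_mem X_mem (mul_mem ihA ihB)
  | @slash A _ ih =>
    have := genFun_image_add_one (v := LSub.size) (w := LTerm.size)
      (fun _ _ h => LSub.slash.inj h) (fun _ => by simp only [LSub.size]; omega) A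
    exact this ▸ mul_mem X_mem ih
  | @lift B _ ih =>
    have := genFun_image_add_one (v := LSub.size) (w := LSub.size)
      (fun _ _ h => LSub.lift.inj h) (fun _ => by simp only [LSub.size]; omega) B
    exact this ▸ mul_mem X_mem ih
  | shift =>
    have := genFun_singleton (w := LSub.size) LSub.shift
    exact this ▸ pow_mem X_mem _

theorem normSet_eq (hk : 1 ≤ k) : normSet k = LTerm.lam '' normSet k ∪
    ((⋃ i ∈ Finset.range (k + 1), image2 LTerm.app (normSet i) (normSet (k - i))) ∪
      closSet k) := by
  ext t
  simp only [normSet, closSet, mem_union, mem_iUnion, Finset.mem_range]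
  constructor
  · intro h
    cases t with
    | idx n => exact absurd (normIn_idx_iff.1 h) (by omega)
    | lam a => exact .inl ⟨a, normIn_lam_iff.1 h, rfl⟩
    | app a b =>
      obtain ⟨i, j, rfl, ha, hb⟩ := normIn_app_iff.1 h
      exact .inr (.inl ⟨i, by omega, a, ha, b, by rwa [Nat.add_sub_cancel_left], rfl⟩)
    | clos u s => exact .inr (.inr ⟨u, s, rfl, h⟩)
  · rintro (⟨a, ha, rfl⟩ | ⟨i, hi, a, ha, b, hb, rfl⟩ | ⟨_, _, -, h⟩)
    · exact normIn_lam_iff.2 ha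
    · exact normIn_app_iff.2 ⟨i, k - i, by omega, ha, hb⟩
    · exact h

theorem Gps_eq (hk : 1 ≤ k) : Gps k = PowerSeries.X * Gps k +
    (∑ i ∈ Finset.range (k + 1), PowerSeries.X * (Gps i * Gps (k - i)) +
      genFun LTerm.size (closSet k)) := by
  conv_lhs => rw [← genFun_normSet, normSet_eq hk]
  rw [genFun_union finite_term_size_eq, genFun_union finite_term_size_eq,
    genFun_biUnion finite_term_size_eq, genFun_lam, genFun_normSet]
  · simp only [genFun_app, genFun_normSet]
  · rintro i j hij
    refine disjoint_left.2 ?_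
    rintro _ ⟨a, ha, b, hb, rfl⟩ ⟨a', ha', b', hb', h⟩
    obtain ⟨rfl, rfl⟩ := LTerm.app.inj h
    exact hij (normIn_unique ha ha')
  · simp only [disjoint_iUnion_left]
    intro i _
    refine disjoint_left.2 ?_
    rintro _ ⟨a, ha, b, hb, rfl⟩ ⟨_, _, h, _⟩
    simp at h
  · simp only [disjoint_union_right, disjoint_iUnion_right]
    refine ⟨fun i _ => disjoint_left.2 ?_, disjoint_left.2 ?_⟩
    · rintro _ ⟨a, -, rfl⟩ ⟨_, _, _, _, h⟩
      simp at h
    · rintro _ ⟨a, -, rfl⟩ ⟨_, _, h, _⟩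
      simp at h

theorem exists_mem_patternSemiring (hk : 1 ≤ k) : ∃ P ∈ patternSemiring k,
    Gps k * (1 - PowerSeries.X - 2 * PowerSeries.X * Gps 0) = P := by
  refine ⟨∑ i ∈ Finset.Ioo 0 k, PowerSeries.X * (Gps i * Gps (k - i)) +
    genFun LTerm.size (closSet k), add_mem (sum_mem fun i hi => ?_)
    (regular_closSet k).genFun_mem, ?_⟩
  · rw [Finset.mem_Ioo] at hi
    exact mul_mem X_mem (mul_mem (Gps_mem (by omega)) (Gps_mem (by omega)))
  · have h := Gps_eq hk
    obtain ⟨m, rfl⟩ : ∃ m, k = m + 1 := ⟨k - 1, by omega⟩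
    have hIoo : Finset.Ioo 0 (m + 1) = (Finset.range m).map ⟨Nat.succ, Nat.succ_injective⟩ := by
      ext i
      simp only [Finset.mem_Ioo, Finset.mem_map, Finset.mem_range, Function.Embedding.coeFn_mk]
      constructor
      · intro hi
        exact ⟨i - 1, by omega, by omega⟩
      · rintro ⟨j, hj, rfl⟩
        omega
    rw [Finset.sum_range_succ, Finset.sum_range_succ'] at h
    simp only [Nat.sub_self, Nat.sub_zero] at h
    rw [hIoo, Finset.sum_map]
    simp only [Function.Embedding.coeFn_mk, Nat.succ_eq_add_one]
    linear_combination h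

/-- The term `(0[↑]) (… ((0[↑]) 0))` with `k` redexes. -/
def redexChain : ℕ → LTerm
  | 0 => .idx 0
  | k + 1 => .app (.clos (.idx 0) .shift) (redexChain k)

theorem normIn_redexChain (k : ℕ) : NormIn (redexChain k) k := by
  induction k with
  | zero => exact .base trivial
  | succ k ih =>
    have h := normIn_app (.step (.varShift 0) (.base trivial)) ih
    rwa [Nat.zero_add, Nat.add_comm] at h

theorem Gps_ne_zero (k : ℕ) : Gps k ≠ 0 := by
  intro h
  have h' := congrArg (PowerSeries.coeff (redexChain k).size) h
  rw [← genFun_normSet, genFun, PowerSeries.coeff_mk, map_zero, Nat.cast_eq_zero,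
    ncard_eq_zero ((finite_term_size_eq _).subset fun _ hx => hx.2)] at h'
  exact eq_empty_iff_forall_notMem.1 h' _ ⟨normIn_redexChain k, rfl⟩

/-- Monomials in `z`, `T`, `S`, `N` and the `G_j` with `j < k`. -/
def IsPatternMonomial (k : ℕ) (f : PowerSeries ℝ) : Prop :=
  ∃ (ζ τ σ ν : ℕ) (ρ : ℕ → ℕ), f = PowerSeries.X ^ ζ * Tps ^ τ * Sps ^ σ * Nps ^ ν *
    ∏ j ∈ Finset.range k, Gps j ^ ρ j

theorem isPatternMonomial_of_mem_closure {f : PowerSeries ℝ}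
    (hf : f ∈ Submonoid.closure ({PowerSeries.X, Tps, Sps, Nps} ∪ Gps '' Iio k)) :
    IsPatternMonomial k f := by
  induction hf using Submonoid.closure_induction with
  | mem f hf =>
    obtain (rfl | rfl | rfl | rfl) | ⟨j, hj, rfl⟩ := hf
    · exact ⟨1, 0, 0, 0, 0, by simp⟩
    · exact ⟨0, 1, 0, 0, 0, by simp⟩
    · exact ⟨0, 0, 1, 0, 0, by simp⟩
    · exact ⟨0, 0, 0, 1, 0, by simp⟩
    · refine ⟨0, 0, 0, 0, Pi.single j 1, ?_⟩
      rw [Finset.prod_eq_single j (fun i _ hi => by simp [hi])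
        (fun h => absurd (Finset.mem_range.2 hj) h)]
      simp
  | one => exact ⟨0, 0, 0, 0, 0, by simp⟩
  | mul f g _ _ hf hg =>
    obtain ⟨ζ, τ, σ, ν, ρ, rfl⟩ := hf
    obtain ⟨ζ', τ', σ', ν', ρ', rfl⟩ := hg
    refine ⟨ζ + ζ', τ + τ', σ + σ', ν + ν', ρ + ρ', ?_⟩
    simp only [Pi.add_apply, pow_add, Finset.prod_mul_distrib]
    ring

theorem exists_sum_of_mem_patternSemiring {P : PowerSeries ℝ} (hP : P ∈ patternSemiring k) :
    ∃ (m : ℕ) (f : Fin m → PowerSeries ℝ), (∀ i, IsPatternMonomial k (f i)) ∧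
      P = ∑ i, f i := by
  rw [patternSemiring, Subsemiring.mem_closure_iff] at hP
  obtain ⟨l, hl, rfl⟩ := AddSubmonoid.exists_list_of_mem_closure hP
  refine ⟨l.length, l.get, fun i => isPatternMonomial_of_mem_closure (hl _ (l.get_mem i)), ?_⟩
  rw [← List.sum_ofFn, List.ofFn_get]

end PatternSemiring

end PsiReduction

/-- For every k ≥ 1 there are a finite non-empty index set and exponents
ζ_i, τ_i, σ_i, ν_i, ρ_{i,0}, …, ρ_{i,k−1} such that, as formal power series,
G_k(z) = (1 − z − 2z·L_∞(z))⁻¹ · ∑_i z^{ζ_i} T(z)^{τ_i} S(z)^{σ_i} N(z)^{ν_i}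
∏_{0 ≤ j < k} G_j(z)^{ρ_{i,j}}, where L_∞ = G_0. -/
theorem Gps_closed_form (k : ℕ) (hk : 1 ≤ k) :
    ∃ (m : ℕ), 0 < m ∧
      ∃ (ζ τ σ ν : Fin m → ℕ) (ρ : Fin m → ℕ → ℕ),
        Gps k = (1 - PowerSeries.X - 2 * PowerSeries.X * Gps 0)⁻¹ *
          ∑ i : Fin m,
            PowerSeries.X ^ (ζ i) * Tps ^ (τ i) * Sps ^ (σ i) * Nps ^ (ν i) *
              ∏ j ∈ Finset.range k, (Gps j) ^ (ρ i j) := by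
  obtain ⟨P, hP, hG⟩ := PsiReduction.exists_mem_patternSemiring hk
  obtain ⟨m, f, hf, rfl⟩ := PsiReduction.exists_sum_of_mem_patternSemiring hP
  have hc : PowerSeries.constantCoeff (R := ℝ)
      (1 - PowerSeries.X - 2 * PowerSeries.X * Gps 0) ≠ 0 := by
    simp
  have hG' : Gps k = (1 - PowerSeries.X - 2 * PowerSeries.X * Gps 0)⁻¹ * ∑ i, f i := by
    rw [mul_comm, PowerSeries.eq_mul_inv_iff_mul_eq hc, hG]
  refine ⟨m, Nat.pos_of_ne_zero ?_, ?_⟩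
  · rintro rfl
    exact PsiReduction.Gps_ne_zero k (by simpa using hG')
  · choose ζ τ σ ν ρ h using hf
    exact ⟨ζ, τ, σ, ν, ρ, by simpa only [h] using hG'⟩
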